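/- arXiv:1412.6330 — 2 statements merged into one kernel-verified Lean document; each statement's English description precedes it below -/
import Mathlib

section
/- For the metric g determined by the real constants a, b, p, q, s, the curvature tensor is determined by: R(∂₂,∂₄) has components R¹₂₂₄ = a x⁴ + p, R¹₃₂₄ = q, R²₄₂₄ = −(a x⁴ + p), R³₄₂₄ = −q; R(∂₃,∂₄) has components R¹₂₃₄ = q, R¹₃₃₄ = b x⁴ + s, R²₄₃₄ = −q, R³₄₃₄ = −(b x⁴ + s); and every component R^i_{jkl} not obtained from these by the antisymmetry R^i_{jkl} = −R^i_{jlk} vanishes. -/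
noncomputable section

open scoped BigOperators

/-- The metric of a four-dimensional two-symmetric Lorentzian manifold, in
coordinates `x 0 = x¹, x 1 = x², x 2 = x³, x 3 = x⁴`:
`g₁₄ = g₄₁ = g₂₂ = g₃₃ = 1`,
`g₄₄ = x⁴(a(x²)² + b(x³)²) + p(x²)² + 2q x²x³ + s(x³)²`, all others zero. -/
def gmat (a b p q s : ℝ) (x : Fin 4 → ℝ) : Matrix (Fin 4) (Fin 4) ℝ :=
  Matrix.of fun i j =>
    if i = 0 ∧ j = 3 then 1
    else if i = 3 ∧ j = 0 then 1
    else if i = 1 ∧ j = 1 then 1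
    else if i = 2 ∧ j = 2 then 1
    else if i = 3 ∧ j = 3 then
      x 3 * (a * (x 1) ^ 2 + b * (x 2) ^ 2) + p * (x 1) ^ 2
        + 2 * q * x 1 * x 2 + s * (x 2) ^ 2
    else 0

/-- The inverse matrix `g^{ij}`. -/
def ginv (a b p q s : ℝ) (x : Fin 4 → ℝ) : Matrix (Fin 4) (Fin 4) ℝ :=
  (gmat a b p q s x)⁻¹

/-- Partial derivative `∂_i` of a function on ℝ⁴. -/
def pd (i : Fin 4) (f : (Fin 4 → ℝ) → ℝ) (x : Fin 4 → ℝ) : ℝ :=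
  fderiv ℝ f x (Pi.single i 1)

/-- Christoffel symbols `Γ^k_{ij} = (1/2) Σ_l g^{kl}(∂_i g_{jl} + ∂_j g_{il} − ∂_l g_{ij})`. -/
def Gam (a b p q s : ℝ) (k i j : Fin 4) (x : Fin 4 → ℝ) : ℝ :=
  (1 / 2) * ∑ l, ginv a b p q s x k l *
    (pd i (fun y => gmat a b p q s y j l) x
      + pd j (fun y => gmat a b p q s y i l) x
      - pd l (fun y => gmat a b p q s y i j) x)

/-- Curvature tensor
`R^i_{jkl} = ∂_k Γ^i_{lj} − ∂_l Γ^i_{kj} + Σ_m (Γ^i_{km} Γ^m_{lj} − Γ^i_{lm} Γ^m_{kj})`. -/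
def Riem (a b p q s : ℝ) (i j k l : Fin 4) (x : Fin 4 → ℝ) : ℝ :=
  pd k (Gam a b p q s i l j) x - pd l (Gam a b p q s i k j) x
    + ∑ m, (Gam a b p q s i k m x * Gam a b p q s m l j x
      - Gam a b p q s i l m x * Gam a b p q s m k j x)

/-- Ricci tensor `ρ_{jl} = Σ_i R^i_{jil}`. -/
def Ric (a b p q s : ℝ) (j l : Fin 4) (x : Fin 4 → ℝ) : ℝ :=
  ∑ i, Riem a b p q s i j i l x

/-- The gradient of the component `g₄₄`. -/
def gradH (a b p q s : ℝ) (i : Fin 4) (x : Fin 4 → ℝ) : ℝ :=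
  if i = 1 then 2 * (x 3 * a + p) * x 1 + 2 * q * x 2
  else if i = 2 then 2 * (x 3 * b + s) * x 2 + 2 * q * x 1
  else if i = 3 then a * (x 1) ^ 2 + b * (x 2) ^ 2
  else 0

/-- The second derivatives of the component `g₄₄`. -/
def hessH (a b p q s : ℝ) (k i : Fin 4) (x : Fin 4 → ℝ) : ℝ :=
  if k = 1 ∧ i = 1 then 2 * (x 3 * a + p)
  else if k = 2 ∧ i = 2 then 2 * (x 3 * b + s)
  else if (k = 1 ∧ i = 2) ∨ (k = 2 ∧ i = 1) then 2 * q
  else if (k = 1 ∧ i = 3) ∨ (k = 3 ∧ i = 1) then 2 * a * x 1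
  else if (k = 2 ∧ i = 3) ∨ (k = 3 ∧ i = 2) then 2 * b * x 2
  else 0

lemma pd_const (i : Fin 4) (c : ℝ) (x : Fin 4 → ℝ) : pd i (fun _ => c) x = 0 := by
  simp [pd]

lemma pd_coord (i j : Fin 4) (x : Fin 4 → ℝ) :
    pd i (fun y => y j) x = if j = i then 1 else 0 := by
  have h : HasFDerivAt (fun y : Fin 4 → ℝ => y j)
      (ContinuousLinearMap.proj (R := ℝ) (φ := fun _ : Fin 4 => ℝ) j) x :=
    (ContinuousLinearMap.proj (R := ℝ) (φ := fun _ : Fin 4 => ℝ) j).hasFDerivAt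
  simp [pd, h.fderiv, Pi.single_apply]

lemma pd_add (i : Fin 4) {f g : (Fin 4 → ℝ) → ℝ} {x : Fin 4 → ℝ}
    (hf : DifferentiableAt ℝ f x) (hg : DifferentiableAt ℝ g x) :
    pd i (fun y => f y + g y) x = pd i f x + pd i g x := by
  simp [pd, fderiv_fun_add hf hg]

lemma pd_mul (i : Fin 4) {f g : (Fin 4 → ℝ) → ℝ} {x : Fin 4 → ℝ}
    (hf : DifferentiableAt ℝ f x) (hg : DifferentiableAt ℝ g x) :
    pd i (fun y => f y * g y) x = f x * pd i g x + g x * pd i f x := by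
  simp [pd, fderiv_fun_mul hf hg]

lemma pd_const_mul (i : Fin 4) (c : ℝ) {f : (Fin 4 → ℝ) → ℝ} {x : Fin 4 → ℝ}
    (hf : DifferentiableAt ℝ f x) :
    pd i (fun y => c * f y) x = c * pd i f x := by
  simp [pd_mul i (differentiableAt_const c) hf, pd_const]

lemma pd_gmat (a b p q s : ℝ) (i j l : Fin 4) (x : Fin 4 → ℝ) :
    pd i (fun y => gmat a b p q s y j l) x =
      if j = 3 ∧ l = 3 then gradH a b p q s i x else 0 := by
  by_cases h : j = 3 ∧ l = 3
  · obtain ⟨rfl, rfl⟩ := h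
    simp only [gmat, Matrix.of_apply, pow_two]
    simp (disch := fun_prop) only [pd_add, pd_mul, pd_const, pd_coord, Fin.reduceEq,
      and_true, and_false, and_self, if_true, if_false]
    fin_cases i <;> simp [gradH] <;> ring
  · rw [if_neg h]
    fin_cases j <;> fin_cases l <;> simp [gmat, pd_const] at h ⊢

lemma ginv_eq (a b p q s : ℝ) (x : Fin 4 → ℝ) :
    ginv a b p q s x =
      !![-gmat a b p q s x 3 3, 0, 0, 1; 0, 1, 0, 0; 0, 0, 1, 0; 1, 0, 0, 0] := by
  refine Matrix.inv_eq_right_inv ?_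
  ext i j
  fin_cases i <;> fin_cases j <;> simp [Matrix.mul_apply, Fin.sum_univ_four, gmat]
  ring

lemma Gam_eq (a b p q s : ℝ) (k i j : Fin 4) :
    Gam a b p q s k i j = fun x =>
      (if k = 0 ∧ j = 3 then 1 / 2 else 0) * gradH a b p q s i x
        + (if k = 0 ∧ i = 3 ∧ j ≠ 3 then 1 / 2 else 0) * gradH a b p q s j x
        + (if (k = 1 ∨ k = 2) ∧ i = 3 ∧ j = 3 then -1 / 2 else 0) * gradH a b p q s k x := by
  funext x
  simp only [Gam, ginv_eq, pd_gmat, Fin.sum_univ_four]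
  fin_cases k <;> fin_cases i <;> fin_cases j <;> simp [gradH] <;> ring

lemma differentiable_gradH (a b p q s : ℝ) (i : Fin 4) :
    Differentiable ℝ (gradH a b p q s i) := by
  unfold gradH
  split_ifs <;> fun_prop

lemma pd_gradH (a b p q s : ℝ) (k i : Fin 4) (x : Fin 4 → ℝ) :
    pd k (gradH a b p q s i) x = hessH a b p q s k i x := by
  change pd k (fun y => gradH a b p q s i y) x = _
  simp only [gradH, pow_two]
  fin_cases i <;>
    simp (disch := fun_prop) [pd_add, pd_mul, pd_const, pd_coord] <;>
    fin_cases k <;> simp [hessH] <;> ring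

lemma pd_Gam (a b p q s : ℝ) (l k i j : Fin 4) (x : Fin 4 → ℝ) :
    pd l (Gam a b p q s k i j) x =
      (if k = 0 ∧ j = 3 then 1 / 2 else 0) * hessH a b p q s l i x
        + (if k = 0 ∧ i = 3 ∧ j ≠ 3 then 1 / 2 else 0) * hessH a b p q s l j x
        + (if (k = 1 ∨ k = 2) ∧ i = 3 ∧ j = 3 then -1 / 2 else 0) *
          hessH a b p q s l k x := by
  have h (m : Fin 4) : DifferentiableAt ℝ (gradH a b p q s m) x :=
    differentiable_gradH a b p q s m x
  have h' (c : ℝ) (m : Fin 4) : DifferentiableAt ℝ (fun y => c * gradH a b p q s m y) x :=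
    (h m).const_mul c
  rw [Gam_eq, pd_add _ ((h' _ i).fun_add (h' _ j)) (h' _ k), pd_add _ (h' _ i) (h' _ j)]
  simp only [pd_const_mul _ _ (h _), pd_gradH]

/-- The quadratic part of the curvature tensor vanishes. -/
lemma sum_Gam_mul_Gam_sub (a b p q s : ℝ) (i j k l : Fin 4) (x : Fin 4 → ℝ) :
    ∑ m, (Gam a b p q s i k m x * Gam a b p q s m l j x
      - Gam a b p q s i l m x * Gam a b p q s m k j x) = 0 := by
  simp only [Gam_eq, Fin.sum_univ_four]
  by_cases hi : i = 0 <;> by_cases hj : j = 3 <;> by_cases hk : k = 3 <;>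
    by_cases hl : l = 3 <;> simp [hi, hj, hk, hl, gradH]

/-- the curvature tensor is determined by
`R¹₂₂₄ = a x⁴ + p`, `R¹₃₂₄ = q`, `R²₄₂₄ = −(a x⁴ + p)`, `R³₄₂₄ = −q`,
`R¹₂₃₄ = q`, `R¹₃₃₄ = b x⁴ + s`, `R²₄₃₄ = −q`, `R³₄₃₄ = −(b x⁴ + s)`,
and every component not obtained from these by `R^i_{jkl} = −R^i_{jlk}` vanishes. -/
theorem curvature_of_two_symmetric (a b p q s : ℝ) (x : Fin 4 → ℝ) (i j k l : Fin 4) :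
    Riem a b p q s i j k l x =
      (if k = 1 ∧ l = 3 then (1 : ℝ) else if k = 3 ∧ l = 1 then -1 else 0) *
        (if i = 0 ∧ j = 1 then a * x 3 + p
         else if i = 0 ∧ j = 2 then q
         else if i = 1 ∧ j = 3 then -(a * x 3 + p)
         else if i = 2 ∧ j = 3 then -q
         else 0)
      + (if k = 2 ∧ l = 3 then (1 : ℝ) else if k = 3 ∧ l = 2 then -1 else 0) *
        (if i = 0 ∧ j = 1 then q
         else if i = 0 ∧ j = 2 then b * x 3 + s
         else if i = 1 ∧ j = 3 then -q
         else if i = 2 ∧ j = 3 then -(b * x 3 + s)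
         else 0) := by
  rw [Riem, sum_Gam_mul_Gam_sub, add_zero, pd_Gam, pd_Gam]
  fin_cases k <;> fin_cases l <;> simp [hessH] <;>
    fin_cases i <;> fin_cases j <;> simp <;> ring
end
end

section
/- For the non-reductive homogeneous space of type A₁ with invariant metric determined by real parameters a, b, c, d with a(a − 4d) ≠ 0 and the Levi-Civita connection given by the explicit endomorphisms Λ[1], Λ[2], Λ[3], Λ[4] (as 4×4 matrices in the parameters a, b, c, d) listed below, the following are equivalent: (i) the space is locally symmetric, i.e. (∇_{u_k}R)(u_i,u_j) = [Λ[k], R(u_i,u_j)] − R(Λ[k]u_i, u_j) − R(u_i, Λ[k]u_j) = 0 for all i,j,k; (ii) b = 0; (iii) the second covariant derivative of the curvature vanishes, ∇²R = 0. -/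
noncomputable section

open scoped BigOperators

namespace A1

variable (a b c d : ℝ)

/-- The isotropy representation `H₁ = Λ(h₁)` for the type `A₁` non-reductive homogeneous
space, with respect to the basis `u₁ = e₁, u₂ = e₂, u₃ = e₅, u₄ = e₃ − e₄`
(0-indexed: `u_i = u (i-1)`). -/
def H1 : Matrix (Fin 4) (Fin 4) ℝ :=
  !![0, -1, 0, 0;
     0, 0, 0, 0;
     0, 0, 0, 0;
     1, 0, -1/2, 0]

/-- The Levi-Civita connection endomorphisms `Λ[1], Λ[2], Λ[3], Λ[4]` of the invariant
metric `g = [[a,0,−a/2,0],[0,b,c,a],[−a/2,c,d,0],[0,a,0,0]]`. -/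
def Lam (a b c d : ℝ) : Fin 4 → Matrix (Fin 4) (Fin 4) ℝ := fun i =>
  if i = 0 then
    !![0, 0, 0, 0;
       0, 1, 0, 0;
       0, 0, 0, 0;
       0, -b/a, -c/a, -1]
  else if i = 1 then
    !![0, -8*b*d/(a*(a - 4*d)), c/a, 1;
       -1, 0, 1/2, 0;
       0, -4*b*c/(a*(a - 4*d)), 0, 0;
       -b/a, 4*b*c/(a*(a - 4*d)), -b/(2*a), 0]
  else if i = 2 then
    !![0, c/a, 0, 0;
       0, 1/2, 0, 0;
       0, 0, 0, 0;
       -c/a, -b/(2*a), 0, -1/2]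
  else 0

/-- `Λ` applied to the bracket `[u_i, u_j] ∈ 𝔤`, using
`[u₁,u₂] = 2u₂`, `[u₁,u₄] = −h₁ − u₄`, `[u₂,u₄] = u₁`, `[u₃,u₄] = (1/2)h₁ − (1/2)u₄`,
all other brackets of basis vectors being zero, and `Λ(h₁) = H₁`. -/
def LamBr (a b c d : ℝ) : Fin 4 → Fin 4 → Matrix (Fin 4) (Fin 4) ℝ := fun i j =>
  if i = 0 ∧ j = 1 then (2 : ℝ) • Lam a b c d 1
  else if i = 1 ∧ j = 0 then -((2 : ℝ) • Lam a b c d 1)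
  else if i = 0 ∧ j = 3 then -(H1 + Lam a b c d 3)
  else if i = 3 ∧ j = 0 then H1 + Lam a b c d 3
  else if i = 1 ∧ j = 3 then Lam a b c d 0
  else if i = 3 ∧ j = 1 then -(Lam a b c d 0)
  else if i = 2 ∧ j = 3 then (1/2 : ℝ) • H1 - (1/2 : ℝ) • Lam a b c d 3
  else if i = 3 ∧ j = 2 then -((1/2 : ℝ) • H1 - (1/2 : ℝ) • Lam a b c d 3)
  else 0

/-- Curvature operators `R(u_i,u_j) = [Λ(u_i), Λ(u_j)] − Λ([u_i,u_j])`. -/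
def Rm (a b c d : ℝ) (i j : Fin 4) : Matrix (Fin 4) (Fin 4) ℝ :=
  Lam a b c d i * Lam a b c d j - Lam a b c d j * Lam a b c d i - LamBr a b c d i j

/-- Covariant derivative of the curvature:
`(∇_{u_k}R)(u_i,u_j) = [Λ[k], R(u_i,u_j)] − R(Λ[k]u_i, u_j) − R(u_i, Λ[k]u_j)`. -/
def DR (a b c d : ℝ) (k i j : Fin 4) : Matrix (Fin 4) (Fin 4) ℝ :=
  Lam a b c d k * Rm a b c d i j - Rm a b c d i j * Lam a b c d k
    - ∑ m, Lam a b c d k m i • Rm a b c d m j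
    - ∑ m, Lam a b c d k m j • Rm a b c d i m

/-- Second covariant derivative of the curvature, computed analogously from `∇R`. -/
def DDR (a b c d : ℝ) (n k i j : Fin 4) : Matrix (Fin 4) (Fin 4) ℝ :=
  Lam a b c d n * DR a b c d k i j - DR a b c d k i j * Lam a b c d n
    - ∑ m, Lam a b c d n m k • DR a b c d m i j
    - ∑ m, Lam a b c d n m i • DR a b c d k m j
    - ∑ m, Lam a b c d n m j • DR a b c d k i m

/-- At `b = 0` the connection depends on the metric only through the ratio `c / a`. -/
lemma Lam_of_b_eq_zero (a c d : ℝ) : Lam a 0 c d =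
    ![!![0, 0, 0, 0; 0, 1, 0, 0; 0, 0, 0, 0; 0, 0, -(c / a), -1],
      !![0, 0, c / a, 1; -1, 0, 1 / 2, 0; 0, 0, 0, 0; 0, 0, 0, 0],
      !![0, c / a, 0, 0; 0, 1 / 2, 0, 0; 0, 0, 0, 0; -(c / a), 0, 0, -(1 / 2)],
      0] := by
  funext i
  fin_cases i <;> simp [Lam, neg_div]

lemma Rm_self (a b c d : ℝ) (i : Fin 4) : Rm a b c d i i = 0 := by
  fin_cases i <;> simp [Rm, LamBr]

lemma Rm_swap (a b c d : ℝ) (i j : Fin 4) : Rm a b c d j i = -Rm a b c d i j := by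
  fin_cases i <;> fin_cases j <;> simp [Rm, LamBr] <;> abel

lemma Rm_zero_one_of_b_eq_zero (a c d : ℝ) : Rm a 0 c d 0 1 =
    !![0, 0, -(c / a), -1; 1, 0, -(1 / 2), 0; 0, 0, 0, 0; 0, 0, 0, 0] := by
  simp only [Rm, LamBr, Lam_of_b_eq_zero]
  ext p q
  fin_cases p <;> fin_cases q <;> simp <;> ring

lemma Rm_zero_two_of_b_eq_zero (a c d : ℝ) : Rm a 0 c d 0 2 =
    !![0, -(c / a), 0, 0; 0, 0, 0, 0; 0, 0, 0, 0; c / a, 0, -(c / a / 2), 0] := by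
  simp only [Rm, LamBr, Lam_of_b_eq_zero]
  ext p q
  fin_cases p <;> fin_cases q <;> simp
  ring

lemma Rm_zero_three_of_b_eq_zero (a c d : ℝ) : Rm a 0 c d 0 3 = H1 := by
  simp [Rm, LamBr, Lam_of_b_eq_zero]

lemma Rm_one_two_of_b_eq_zero (a c d : ℝ) : Rm a 0 c d 1 2 =
    !![0, 0, -(c / a / 2), -(1 / 2); 1 / 2, -(c / a), -(1 / 4), 0; 0, 0, 0, 0;
       0, 0, (c / a) ^ 2, c / a] := by
  simp only [Rm, LamBr, Lam_of_b_eq_zero]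
  ext p q
  fin_cases p <;> fin_cases q <;> simp <;> ring

lemma Rm_one_three_of_b_eq_zero (a c d : ℝ) : Rm a 0 c d 1 3 =
    !![0, 0, 0, 0; 0, -1, 0, 0; 0, 0, 0, 0; 0, 0, c / a, 1] := by
  simp [Rm, LamBr, Lam_of_b_eq_zero]

lemma Rm_two_three_of_b_eq_zero (a c d : ℝ) : Rm a 0 c d 2 3 = -((1 / 2 : ℝ) • H1) := by
  simp [Rm, LamBr, Lam_of_b_eq_zero]

lemma DR_self (a b c d : ℝ) (k i : Fin 4) : DR a b c d k i i = 0 := by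
  simp [DR, Rm_self, fun m => Rm_swap a b c d m i]

lemma DR_swap (a b c d : ℝ) (k i j : Fin 4) : DR a b c d k j i = -DR a b c d k i j := by
  have hi (m) : Rm a b c d m i = -Rm a b c d i m := Rm_swap a b c d i m
  have hj (m) : Rm a b c d j m = -Rm a b c d m j := Rm_swap a b c d m j
  simp only [DR, hi, hj, Finset.sum_neg_distrib, smul_neg, mul_neg, neg_mul]
  abel

lemma DR_three (a b c d : ℝ) (i j : Fin 4) : DR a b c d 3 i j = 0 := by
  have hLam : Lam a b c d 3 = 0 := by simp [Lam]
  simp [DR, hLam]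

lemma DR_of_b_eq_zero_of_lt (a c d : ℝ) (k : Fin 4) {i j : Fin 4} (hij : i < j) :
    DR a 0 c d k i j = 0 := by
  have swap (i j) := Rm_swap a 0 c d i j
  have of_eq_zero (v : Fin 4 → Fin 4 → ℝ) : Matrix.of v = 0 ↔ v = 0 := Iff.rfl
  fin_cases k
  on_goal 4 => exact DR_three a 0 c d i j
  all_goals fin_cases i <;> fin_cases j <;> first
    | exact absurd hij (by decide)
    | (simp [DR, Fin.sum_univ_four, Rm_self, swap 0 1, swap 0 2, swap 1 2, swap 1 3,
        swap 2 3, Rm_zero_one_of_b_eq_zero, Rm_zero_two_of_b_eq_zero,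
        Rm_zero_three_of_b_eq_zero, Rm_one_two_of_b_eq_zero, Rm_one_three_of_b_eq_zero,
        Rm_two_three_of_b_eq_zero, Lam_of_b_eq_zero, H1, of_eq_zero,
        Matrix.cons_eq_zero_iff] <;>
      (repeat' apply And.intro) <;> ring)

lemma DR_of_b_eq_zero (a c d : ℝ) (k i j : Fin 4) : DR a 0 c d k i j = 0 := by
  rcases lt_trichotomy i j with hij | rfl | hij
  · exact DR_of_b_eq_zero_of_lt a c d k hij
  · exact DR_self a 0 c d k i
  · rw [DR_swap, DR_of_b_eq_zero_of_lt a c d k hij, neg_zero]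

lemma DR_zero_zero_three (a b c d : ℝ) : DR a b c d 0 0 3 = 0 := by
  ext p q
  fin_cases p <;> fin_cases q <;>
    simp [DR, Rm, LamBr, Lam, H1, Fin.sum_univ_four]

lemma DR_zero_zero_one_col_zero (a b c d : ℝ) (p : Fin 4) :
    DR a b c d 0 0 1 p 0 = ![0, 0, 0, -8 * b / a] p := by
  fin_cases p <;>
    simp [DR, Rm, LamBr, Lam, H1, Fin.sum_univ_four]
  ring

lemma DDR_zero_zero_zero_one_apply (a b c d : ℝ) :
    DDR a b c d 0 0 0 1 3 0 = 16 * b / a := by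
  have hleft : (Lam a b c d 0 * DR a b c d 0 0 1) 3 0 = 8 * b / a := by
    simp only [Matrix.mul_apply, Fin.sum_univ_four, DR_zero_zero_one_col_zero]
    simp [Lam, neg_div]
  have hright : (DR a b c d 0 0 1 * Lam a b c d 0) 3 0 = 0 := by
    simp only [Matrix.mul_apply, Fin.sum_univ_four]
    simp [Lam]
  have hcol (m : Fin 4) : Lam a b c d 0 m 0 = 0 := by
    fin_cases m <;> simp [Lam]
  have hcol_one : Lam a b c d 0 0 1 = 0 ∧ Lam a b c d 0 1 1 = 1 ∧ Lam a b c d 0 2 1 = 0 := by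
    simp [Lam]
  simp only [DDR, Matrix.sub_apply, hleft, hright, hcol, Fin.sum_univ_four, hcol_one,
    DR_zero_zero_three, DR_zero_zero_one_col_zero, Matrix.add_apply,
    Matrix.zero_apply, smul_zero, zero_smul, one_smul, Matrix.cons_val]
  ring

/-- for the type `A₁` non-reductive homogeneous space with invariant
metric determined by `a, b, c, d` with `a(a − 4d) ≠ 0`, the following are equivalent:
(i) the space is locally symmetric (`∇R = 0`); (ii) `b = 0`; (iii) `∇²R = 0`. -/
theorem locally_symmetric_iff (a b c d : ℝ) (h : a * (a - 4 * d) ≠ 0) :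
    ((∀ k i j : Fin 4, DR a b c d k i j = 0) ↔ b = 0) ∧
    (b = 0 ↔ (∀ n k i j : Fin 4, DDR a b c d n k i j = 0)) := by
  have ha : a ≠ 0 := left_ne_zero_of_mul h
  refine ⟨⟨fun hD => ?_, ?_⟩, ?_, fun hD => ?_⟩
  · have h30 := DR_zero_zero_one_col_zero a b c d 3
    rw [hD] at h30
    simpa [ha] using h30.symm
  · rintro rfl k i j
    exact DR_of_b_eq_zero a c d k i j
  · rintro rfl n k i j
    simp [DDR, DR_of_b_eq_zero]
  · have h30 := DDR_zero_zero_zero_one_apply a b c d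
    rw [hD] at h30
    simpa [ha] using h30.symm

end A1
end
end
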